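/- arXiv:2507.22967 — 8 statements merged into one kernel-verified Lean document; each statement's English description precedes it below -/
import Mathlib

section
/- Let α > 0, η ∈ ℝ and γ < -1, and let f be the log-EVBS(α,η,γ) density. Then f is strictly monotonically increasing on the open interval (η, η + 2·arcsinh(-α/(2γ))). -/
/-- Let `α > 0`, `η ∈ ℝ` and `γ < -1`, and let `f` be the
log-EVBS(α,η,γ) density, i.e. on the set where `1 + γ·ξ₂(y) > 0` (with
`ξ₁(y) = (2/α)·cosh((y-η)/2)` and `ξ₂(y) = (2/α)·sinh((y-η)/2)`) one has
`f y = (1/2)·ξ₁(y)·(1+γ·ξ₂(y))^(-1-1/γ)·exp(-(1+γ·ξ₂(y))^(-1/γ))`.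
Then `f` is strictly monotonically increasing on the open interval
`(η, η + 2·arcsinh(-α/(2γ)))`. -/
theorem logEVBS_strictMonoOn_of_gamma_lt_neg_one
    (α η γ : ℝ) (hα : 0 < α) (hγ : γ < -1) (f : ℝ → ℝ)
    (hf : ∀ y : ℝ,
      0 < 1 + γ * ((2 / α) * Real.sinh ((y - η) / 2)) →
      f y = (1 / 2) * ((2 / α) * Real.cosh ((y - η) / 2)) *
        (1 + γ * ((2 / α) * Real.sinh ((y - η) / 2))) ^ (-1 - 1 / γ) *
        Real.exp (-(1 + γ * ((2 / α) * Real.sinh ((y - η) / 2))) ^ (-1 / γ))) :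
    StrictMonoOn f (Set.Ioo η (η + 2 * Real.arsinh (-α / (2 * γ)))) := by
  have hγ0 : γ < 0 := by linarith
  have hpos : ∀ y : ℝ, y < η + 2 * Real.arsinh (-α / (2 * γ)) →
      0 < 1 + γ * ((2 / α) * Real.sinh ((y - η) / 2)) := by
    intro y hy
    have h1 : Real.sinh ((y - η) / 2) < -α / (2 * γ) := by
      rw [← Real.sinh_arsinh (-α / (2 * γ))]
      exact Real.sinh_lt_sinh.mpr (by linarith)
    have h2 : γ * (2 / α) * (-α / (2 * γ)) = -1 := by
      have := hγ0.ne
      field_simp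
    have h3 : γ * (2 / α) < 0 := mul_neg_of_neg_of_pos hγ0 (by positivity)
    have h4 := mul_lt_mul_of_neg_left h1 h3
    linarith
  intro x hx y hy hxy
  have hux := hpos x hx.2
  have huy := hpos y hy.2
  rw [hf x hux, hf y huy]
  have hs : Real.sinh ((x - η) / 2) < Real.sinh ((y - η) / 2) :=
    Real.sinh_lt_sinh.mpr (by linarith)
  have hc : Real.cosh ((x - η) / 2) < Real.cosh ((y - η) / 2) := by
    rw [Real.cosh_lt_cosh, abs_of_pos (by linarith [hx.1]), abs_of_pos (by linarith [hy.1])]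
    linarith
  have hu : 1 + γ * ((2 / α) * Real.sinh ((y - η) / 2)) <
      1 + γ * ((2 / α) * Real.sinh ((x - η) / 2)) := by
    have h3 : γ * (2 / α) < 0 := mul_neg_of_neg_of_pos hγ0 (by positivity)
    have h4 := mul_lt_mul_of_neg_left hs h3
    linarith
  have hg : 0 < -1 / γ := div_pos_of_neg_of_neg (by norm_num) hγ0
  have hg1 : -1 / γ < 1 := by
    rw [div_lt_iff_of_neg hγ0]
    linarith
  have he : -1 - 1 / γ < 0 := by
    have : -1 / γ = -(1 / γ) := by ring
    linarith
  generalize 1 + γ * ((2 / α) * Real.sinh ((x - η) / 2)) = u at *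
  generalize 1 + γ * ((2 / α) * Real.sinh ((y - η) / 2)) = v at *
  have hp : u ^ (-1 - 1 / γ) < v ^ (-1 - 1 / γ) := Real.rpow_lt_rpow_of_neg huy hu he
  have hq : v ^ (-1 / γ) < u ^ (-1 / γ) := Real.rpow_lt_rpow huy.le hu hg
  have hE : Real.exp (-u ^ (-1 / γ)) < Real.exp (-v ^ (-1 / γ)) :=
    Real.exp_lt_exp.mpr (neg_lt_neg hq)
  have hcx := Real.cosh_pos ((x - η) / 2)
  have hcy := Real.cosh_pos ((y - η) / 2)
  have hup := Real.rpow_pos_of_pos hux (-1 - 1 / γ)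
  have hvp := Real.rpow_pos_of_pos huy (-1 - 1 / γ)
  have hA : (1 / 2) * ((2 / α) * Real.cosh ((x - η) / 2)) <
      (1 / 2) * ((2 / α) * Real.cosh ((y - η) / 2)) := by gcongr
  have hB := mul_lt_mul'' hA hp (by positivity) hup.le
  exact mul_lt_mul'' hB hE (by positivity) (Real.exp_pos _).le
end

section
/- Let α ≥ 4, η ∈ ℝ, γ = -1, and let f be the log-EVBS(α,η,-1) density. Set y₁ = η + 2·arcsinh(-α/4 - (1/4)·√(α²-16)) and y₂ = η + 2·arcsinh(-α/4 + (1/4)·√(α²-16)). Then f is monotonically increasing on the interval (-∞, y₁) and monotonically increasing on the interval (y₂, η + 2·arcsinh(α/2)). -/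
lemma aux_mono (a η : ℝ) (ha : 0 < a) (D : Set ℝ) (hD : Convex ℝ D) 
    (h : ∀ y ∈ D, 0 ≤ Real.sinh ((y - η) / 2) ^ 2 + a / 2 * Real.sinh ((y - η) / 2) + 1) :
    MonotoneOn (fun y => Real.cosh ((y - η) / 2) *
      Real.exp (-(1 + -1 * ((2 / a) * Real.sinh ((y - η) / 2))))) D := by
  have hd : ∀ y : ℝ, HasDerivAt (fun y => Real.cosh ((y - η) / 2) *
      Real.exp (-(1 + -1 * ((2 / a) * Real.sinh ((y - η) / 2)))))
      ((Real.sinh ((y - η) / 2) * (1 / 2)) *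
        Real.exp (-(1 + -1 * ((2 / a) * Real.sinh ((y - η) / 2)))) +
       Real.cosh ((y - η) / 2) * (Real.exp (-(1 + -1 * ((2 / a) * Real.sinh ((y - η) / 2)))) *
        (-(-1 * ((2 / a) * (Real.cosh ((y - η) / 2) * (1 / 2))))))) y := by
    intro y
    have h1 : HasDerivAt (fun y : ℝ => (y - η) / 2) (1 / 2) y :=
      ((hasDerivAt_id y).sub_const η).div_const 2
    exact h1.cosh.mul (((((h1.sinh).const_mul (2 / a)).const_mul (-1)).const_add 1).neg.exp)
  refine monotoneOn_of_deriv_nonneg hD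
    (fun y _ => (hd y).continuousAt.continuousWithinAt)
    (fun y _ => (hd y).differentiableAt.differentiableWithinAt) ?_
  intro y hy
  rw [(hd y).deriv]
  have h2 := h y (interior_subset hy)
  have hc := Real.cosh_sq ((y - η) / 2)
  have he := Real.exp_pos (-(1 + -1 * ((2 / a) * Real.sinh ((y - η) / 2))))
  generalize Real.exp (-(1 + -1 * ((2 / a) * Real.sinh ((y - η) / 2)))) = E at *
  generalize Real.sinh ((y - η) / 2) = s at *
  generalize Real.cosh ((y - η) / 2) = c at *
  have : s * (1 / 2) * E + c * (E * (-(-1 * (2 / a * (c * (1 / 2))))))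
      = E / a * (s ^ 2 + a / 2 * s + 1) := by
    rw [← add_right_comm, ← hc]
    field_simp
    ring
  rw [this]
  positivity

lemma aux_main (α η : ℝ) (hα : 4 ≤ α) (f : ℝ → ℝ)
    (hf : ∀ y : ℝ,
      0 < 1 + (-1) * ((2 / α) * Real.sinh ((y - η) / 2)) →
      f y = (1 / 2) * ((2 / α) * Real.cosh ((y - η) / 2)) *
        (1 + (-1) * ((2 / α) * Real.sinh ((y - η) / 2))) ^ ((-1 : ℝ) - 1 / (-1)) *
        Real.exp (-(1 + (-1) * ((2 / α) * Real.sinh ((y - η) / 2))) ^ ((-1 : ℝ) / (-1))))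
    (D : Set ℝ) (hD : Convex ℝ D)
    (h : ∀ y ∈ D, 0 ≤ Real.sinh ((y - η) / 2) ^ 2 + α / 2 * Real.sinh ((y - η) / 2) + 1)
    (h' : ∀ y ∈ D, Real.sinh ((y - η) / 2) < α / 2) : MonotoneOn f D := by
  have ha : 0 < α := by linarith
  have key : ∀ y ∈ D, f y = 1 / α * (Real.cosh ((y - η) / 2) *
      Real.exp (-(1 + -1 * ((2 / α) * Real.sinh ((y - η) / 2))))) := by
    intro y hy
    have hp : 0 < 1 + (-1) * ((2 / α) * Real.sinh ((y - η) / 2)) := by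
      have := mul_lt_mul_of_pos_left (h' y hy) (show 0 < 2 / α by positivity)
      have e : 2 / α * (α / 2) = 1 := by field_simp
      linarith
    rw [hf y hp]
    have e1 : (-1 : ℝ) - 1 / (-1) = 0 := by norm_num
    have e2 : (-1 : ℝ) / (-1) = 1 := by norm_num
    rw [e1, e2, Real.rpow_zero, Real.rpow_one]
    ring
  intro x hx y hy hxy
  rw [key x hx, key y hy]
  exact mul_le_mul_of_nonneg_left (aux_mono α η ha D hD h hx hy hxy) (by positivity)

/-- Let `α ≥ 4`, `η ∈ ℝ`, `γ = -1`, and let `f` be the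
log-EVBS(α,η,-1) density, i.e. on the set where `1 + γ·ξ₂(y) > 0` (with
`ξ₁(y) = (2/α)·cosh((y-η)/2)` and `ξ₂(y) = (2/α)·sinh((y-η)/2)`) one has
`f y = (1/2)·ξ₁(y)·(1+γ·ξ₂(y))^(-1-1/γ)·exp(-(1+γ·ξ₂(y))^(-1/γ))`.
Set `y₁ = η + 2·arcsinh(-α/4 - (1/4)·√(α²-16))` and
`y₂ = η + 2·arcsinh(-α/4 + (1/4)·√(α²-16))`.  Then `f` is monotonically
increasing on `(-∞, y₁)` and monotonically increasing on
`(y₂, η + 2·arcsinh(α/2))`. -/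
theorem logEVBS_monotoneOn_of_gamma_eq_neg_one_of_four_le
    (α η γ : ℝ) (hα : 4 ≤ α) (hγ : γ = -1) (f : ℝ → ℝ)
    (hf : ∀ y : ℝ,
      0 < 1 + γ * ((2 / α) * Real.sinh ((y - η) / 2)) →
      f y = (1 / 2) * ((2 / α) * Real.cosh ((y - η) / 2)) *
        (1 + γ * ((2 / α) * Real.sinh ((y - η) / 2))) ^ (-1 - 1 / γ) *
        Real.exp (-(1 + γ * ((2 / α) * Real.sinh ((y - η) / 2))) ^ (-1 / γ))) :
    MonotoneOn f
      (Set.Iio (η + 2 * Real.arsinh (-α / 4 - (1 / 4) * Real.sqrt (α ^ 2 - 16)))) ∧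
    MonotoneOn f
      (Set.Ioo (η + 2 * Real.arsinh (-α / 4 + (1 / 4) * Real.sqrt (α ^ 2 - 16)))
        (η + 2 * Real.arsinh (α / 2))) := by
  subst hγ
  have hs : Real.sqrt (α ^ 2 - 16) ^ 2 = α ^ 2 - 16 := Real.sq_sqrt (by nlinarith)
  have hs0 := Real.sqrt_nonneg (α ^ 2 - 16)
  have lt1 : ∀ y u : ℝ, y < η + 2 * Real.arsinh u → Real.sinh ((y - η) / 2) < u := by
    intro y u h
    rw [← Real.sinh_arsinh u, Real.sinh_lt_sinh]
    linarith
  have lt2 : ∀ y u : ℝ, η + 2 * Real.arsinh u < y → u < Real.sinh ((y - η) / 2) := by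
    intro y u h
    rw [← Real.sinh_arsinh u, Real.sinh_lt_sinh]
    linarith
  constructor
  · refine aux_main α η hα f hf _ (convex_Iio _) ?_ ?_
    · intro y hy
      have := lt1 y _ hy
      nlinarith
    · intro y hy
      have := lt1 y _ hy
      linarith
  · refine aux_main α η hα f hf _ (convex_Ioo _ _) ?_ ?_
    · intro y hy
      have := lt2 y _ hy.1
      nlinarith
    · intro y hy
      exact lt1 y _ hy.2
end

section
/- Let α ≥ 4, η ∈ ℝ, γ = -1, and let f be the log-EVBS(α,η,-1) density. Set y₁ = η + 2·arcsinh(-α/4 - (1/4)·√(α²-16)) and y₂ = η + 2·arcsinh(-α/4 + (1/4)·√(α²-16)). Then f is monotonically decreasing on the interval (y₁, y₂). -/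
/-- Let `α ≥ 4`, `η ∈ ℝ`, `γ = -1`, and let `f` be the
log-EVBS(α,η,-1) density, i.e. on the set where `1 + γ·ξ₂(y) > 0` (with
`ξ₁(y) = (2/α)·cosh((y-η)/2)` and `ξ₂(y) = (2/α)·sinh((y-η)/2)`) one has
`f y = (1/2)·ξ₁(y)·(1+γ·ξ₂(y))^(-1-1/γ)·exp(-(1+γ·ξ₂(y))^(-1/γ))`.
Set `y₁ = η + 2·arcsinh(-α/4 - (1/4)·√(α²-16))` and
`y₂ = η + 2·arcsinh(-α/4 + (1/4)·√(α²-16))`.  Then `f` is monotonically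
decreasing on the interval `(y₁, y₂)`. -/
theorem logEVBS_antitoneOn_of_gamma_eq_neg_one_of_four_le
    (α η γ : ℝ) (hα : 4 ≤ α) (hγ : γ = -1) (f : ℝ → ℝ)
    (hf : ∀ y : ℝ,
      0 < 1 + γ * ((2 / α) * Real.sinh ((y - η) / 2)) →
      f y = (1 / 2) * ((2 / α) * Real.cosh ((y - η) / 2)) *
        (1 + γ * ((2 / α) * Real.sinh ((y - η) / 2))) ^ (-1 - 1 / γ) *
        Real.exp (-(1 + γ * ((2 / α) * Real.sinh ((y - η) / 2))) ^ (-1 / γ))) :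
    AntitoneOn f
      (Set.Ioo (η + 2 * Real.arsinh (-α / 4 - (1 / 4) * Real.sqrt (α ^ 2 - 16)))
        (η + 2 * Real.arsinh (-α / 4 + (1 / 4) * Real.sqrt (α ^ 2 - 16)))) := by
  subst hγ
  have hα0 : 0 < α := by linarith
  set r := Real.sqrt (α ^ 2 - 16) with hr
  have hr0 : 0 ≤ r := Real.sqrt_nonneg _
  have hr2 : r ^ 2 = α ^ 2 - 16 := Real.sq_sqrt (by nlinarith)
  have hrα : r < α := by nlinarith
  set a := η + 2 * Real.arsinh (-α / 4 - (1 / 4) * r) with ha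
  set b := η + 2 * Real.arsinh (-α / 4 + (1 / 4) * r) with hb
  have key : ∀ y ∈ Set.Ioo a b, -α / 4 - (1 / 4) * r < Real.sinh ((y - η) / 2) ∧
      Real.sinh ((y - η) / 2) < -α / 4 + (1 / 4) * r := by
    intro y hy
    have h1 : Real.arsinh (-α / 4 - (1 / 4) * r) < (y - η) / 2 := by
      have := hy.1
      rw [ha] at this
      linarith
    have h2 : (y - η) / 2 < Real.arsinh (-α / 4 + (1 / 4) * r) := by
      have := hy.2
      rw [hb] at this
      linarith
    have h3 := Real.sinh_lt_sinh.2 h1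
    have h4 := Real.sinh_lt_sinh.2 h2
    rw [Real.sinh_arsinh] at h3 h4
    exact ⟨h3, h4⟩
  have hd : ∀ y : ℝ, HasDerivAt (fun y : ℝ => (1 / α) * Real.cosh ((y - η) / 2) *
      Real.exp (-1 + (2 / α) * Real.sinh ((y - η) / 2)))
      ((1 / α) * (Real.sinh ((y - η) / 2) * (1 / 2)) *
        Real.exp (-1 + (2 / α) * Real.sinh ((y - η) / 2)) +
       (1 / α) * Real.cosh ((y - η) / 2) *
        (Real.exp (-1 + (2 / α) * Real.sinh ((y - η) / 2)) *
          ((2 / α) * (Real.cosh ((y - η) / 2) * (1 / 2))))) y := by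
    intro y
    have h0 : HasDerivAt (fun y : ℝ => (y - η) / 2) (1 / 2) y :=
      ((hasDerivAt_id y).sub_const η).div_const 2
    exact (h0.cosh.const_mul (1 / α)).mul (((h0.sinh.const_mul (2 / α)).const_add (-1)).exp)
  have hg : AntitoneOn (fun y : ℝ => (1 / α) * Real.cosh ((y - η) / 2) *
      Real.exp (-1 + (2 / α) * Real.sinh ((y - η) / 2))) (Set.Ioo a b) := by
    apply antitoneOn_of_deriv_nonpos (convex_Ioo a b)
    · exact fun y _ => (hd y).continuousAt.continuousWithinAt
    · exact fun y _ => (hd y).differentiableAt.differentiableWithinAt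
    · intro y hy
      rw [interior_Ioo] at hy
      obtain ⟨h1, h2⟩ := key y hy
      rw [(hd y).deriv]
      have hc := Real.cosh_sq ((y - η) / 2)
      set s := Real.sinh ((y - η) / 2)
      set c := Real.cosh ((y - η) / 2)
      set E := Real.exp (-1 + (2 / α) * s)
      have hE : 0 < E := Real.exp_pos _
      have hq : s ^ 2 + α * s / 2 + 1 ≤ 0 := by
        nlinarith [mul_pos (sub_pos.2 h1) (sub_pos.2 h2)]
      have : (1 / α) * (s * (1 / 2)) * E + (1 / α) * c * (E * ((2 / α) * (c * (1 / 2))))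
          = (E / α ^ 2) * (c ^ 2 + α * s / 2) := by
        field_simp
        ring
      rw [this, hc]
      exact mul_nonpos_of_nonneg_of_nonpos (by positivity) (by linarith)
  refine hg.congr ?_
  intro y hy
  have hs : Real.sinh ((y - η) / 2) < 0 := by linarith [(key y hy).2]
  have hp : 0 < 1 + (-1) * ((2 / α) * Real.sinh ((y - η) / 2)) := by
    have := mul_neg_of_pos_of_neg (show 0 < 2 / α by positivity) hs
    linarith
  have e1 : (-1 - 1 / (-1) : ℝ) = 0 := by norm_num
  have e2 : (-1 / (-1) : ℝ) = 1 := by norm_num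
  rw [hf y hp, e1, e2, Real.rpow_zero, Real.rpow_one]
  have e3 : -(1 + (-1) * ((2 / α) * Real.sinh ((y - η) / 2)))
      = -1 + (2 / α) * Real.sinh ((y - η) / 2) := by ring
  rw [e3]
  ring
end

section
/- Let 0 < α < 4, η ∈ ℝ, γ = -1, and let f be the log-EVBS(α,η,-1) density. Then f is strictly monotonically increasing on the interval (-∞, η + 2·arcsinh(α/2)). -/
/-- Let `0 < α < 4`, `η ∈ ℝ`, `γ = -1`, and let `f` be the
log-EVBS(α,η,-1) density, i.e. on the set where `1 + γ·ξ₂(y) > 0` (with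
`ξ₁(y) = (2/α)·cosh((y-η)/2)` and `ξ₂(y) = (2/α)·sinh((y-η)/2)`) one has
`f y = (1/2)·ξ₁(y)·(1+γ·ξ₂(y))^(-1-1/γ)·exp(-(1+γ·ξ₂(y))^(-1/γ))`.
Then `f` is strictly monotonically increasing on `(-∞, η + 2·arcsinh(α/2))`. -/
theorem logEVBS_strictMonoOn_of_gamma_eq_neg_one_of_lt_four
    (α η γ : ℝ) (hα : 0 < α) (hα4 : α < 4) (hγ : γ = -1) (f : ℝ → ℝ)
    (hf : ∀ y : ℝ,
      0 < 1 + γ * ((2 / α) * Real.sinh ((y - η) / 2)) →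
      f y = (1 / 2) * ((2 / α) * Real.cosh ((y - η) / 2)) *
        (1 + γ * ((2 / α) * Real.sinh ((y - η) / 2))) ^ (-1 - 1 / γ) *
        Real.exp (-(1 + γ * ((2 / α) * Real.sinh ((y - η) / 2))) ^ (-1 / γ))) :
    StrictMonoOn f (Set.Iio (η + 2 * Real.arsinh (α / 2))) := by
  have ha : 1 / 2 < 2 / α := by
    rw [div_lt_div_iff₀ (by norm_num) hα]; linarith
  subst hγ
  have hmono : StrictMono (fun x : ℝ => Real.cosh x * Real.exp ((2 / α) * Real.sinh x)) := by
    apply strictMono_of_deriv_pos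
    intro x
    have h := (Real.hasDerivAt_cosh x).mul (((Real.hasDerivAt_sinh x).const_mul (2 / α)).exp)
    have h2 : deriv (fun x : ℝ => Real.cosh x * Real.exp ((2 / α) * Real.sinh x)) x = _ := h.deriv
    rw [h2]
    have h3 : 0 < Real.sinh x + (2 / α) * Real.cosh x ^ 2 := by
      rw [Real.cosh_sq]
      nlinarith [sq_nonneg (Real.sinh x + 1), sq_nonneg (Real.sinh x)]
    have h4 := mul_pos h3 (Real.exp_pos ((2 / α) * Real.sinh x))
    linarith
  have key : ∀ y ∈ Set.Iio (η + 2 * Real.arsinh (α / 2)),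
      f y = (1 / α * Real.exp (-1)) *
        (Real.cosh ((y - η) / 2) * Real.exp ((2 / α) * Real.sinh ((y - η) / 2))) := by
    intro y hy
    have hy1 : (y - η) / 2 < Real.arsinh (α / 2) := by
      have := Set.mem_Iio.mp hy
      linarith
    have hy2 : Real.sinh ((y - η) / 2) < α / 2 := by
      have := Real.sinh_lt_sinh.mpr hy1
      rwa [Real.sinh_arsinh] at this
    have hy3 : (2 / α) * Real.sinh ((y - η) / 2) < 1 := by
      calc (2 / α) * Real.sinh ((y - η) / 2) < (2 / α) * (α / 2) := by gcongr
        _ = 1 := by field_simp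
    rw [hf y (by linarith)]
    have e1 : (-1 - 1 / (-1) : ℝ) = 0 := by norm_num
    have e2 : (-1 / (-1) : ℝ) = 1 := by norm_num
    rw [e1, e2, Real.rpow_zero, Real.rpow_one]
    have e3 : -(1 + -1 * ((2 / α) * Real.sinh ((y - η) / 2)))
        = -1 + (2 / α) * Real.sinh ((y - η) / 2) := by ring
    rw [e3, Real.exp_add]
    ring
  intro y hy z hz hyz
  rw [key y hy, key z hz]
  have := hmono (show (y - η) / 2 < (z - η) / 2 by linarith)
  exact mul_lt_mul_of_pos_left this (by positivity)
end

section
/- Let 0 < α < 2, η ∈ ℝ, γ = 0, and let f be the log-EVBS(α,η,0) density. Then η is a local maximum point of f, and f is strictly monotonically increasing on the interval (-∞, η). -/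
/-- Let `0 < α < 2`, `η ∈ ℝ`, `γ = 0`, and let `f` be the
log-EVBS(α,η,0) density, i.e.
`f y = (1/2)·ξ₁(y)·exp(-ξ₂(y) - exp(-ξ₂(y)))` for all `y ∈ ℝ`, where
`ξ₁(y) = (2/α)·cosh((y-η)/2)` and `ξ₂(y) = (2/α)·sinh((y-η)/2)`.
Then `η` is a local maximum point of `f`, and `f` is strictly monotonically
increasing on `(-∞, η)`. -/
theorem logEVBS_isLocalMax_and_strictMonoOn_of_gamma_eq_zero
    (α η : ℝ) (hα : 0 < α) (hα2 : α < 2) (f : ℝ → ℝ)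
    (hf : ∀ y : ℝ,
      f y = (1 / 2) * ((2 / α) * Real.cosh ((y - η) / 2)) *
        Real.exp (-((2 / α) * Real.sinh ((y - η) / 2)) -
          Real.exp (-((2 / α) * Real.sinh ((y - η) / 2))))) :
    IsLocalMax f η ∧ StrictMonoOn f (Set.Iio η) := by
  obtain ⟨a, ha⟩ : ∃ a, a = 2 / α := ⟨_, rfl⟩
  have ha1 : 1 < a := by rw [ha, lt_div_iff₀ hα]; linarith
  simp only [← ha] at hf
  have hd : ∀ y, HasDerivAt f (a / 4 * Real.exp (-(a * Real.sinh ((y - η) / 2)) -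
          Real.exp (-(a * Real.sinh ((y - η) / 2)))) *
      (Real.sinh ((y - η) / 2) + a * Real.cosh ((y - η) / 2) ^ 2 *
        (Real.exp (-(a * Real.sinh ((y - η) / 2))) - 1))) y := by
    intro y
    have ht : HasDerivAt (fun y : ℝ => (y - η) / 2) (1 / 2) y :=
      ((hasDerivAt_id y).sub_const η).div_const 2
    have hs := (ht.sinh.const_mul a).neg
    have hc := (ht.cosh.const_mul a).const_mul (1 / 2)
    have h := hc.mul (hs.sub hs.exp).exp
    have hfe : f = _ := funext hf
    rw [hfe]
    refine h.congr_deriv ?_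
    simp only [Pi.neg_apply, Pi.sub_apply]
    ring
  have hneg : ∀ y, y < η → 0 < deriv f y := by
    intro y hy
    rw [(hd y).deriv]
    have hu : Real.sinh ((y - η) / 2) < 0 := Real.sinh_neg_iff.2 (by linarith)
    have hc := Real.cosh_sq ((y - η) / 2)
    have he := Real.add_one_le_exp (-(a * Real.sinh ((y - η) / 2)))
    refine mul_pos (mul_pos (by linarith) (Real.exp_pos _)) ?_
    generalize Real.sinh ((y - η) / 2) = u at *
    rw [hc]
    generalize Real.exp (-(a * u)) = e at *
    have h1 : a * (u ^ 2 + 1) * (-(a * u)) ≤ a * (u ^ 2 + 1) * (e - 1) :=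
      mul_le_mul_of_nonneg_left (by linarith) (by positivity)
    have h2 : 1 < a ^ 2 * (u ^ 2 + 1) := by nlinarith [mul_nonneg (sq_nonneg a) (sq_nonneg u)]
    nlinarith [mul_pos (neg_pos.2 hu) (sub_pos.2 h2)]
  have hcont : Continuous f := continuous_iff_continuousAt.2 fun y => (hd y).continuousAt
  refine ⟨?_, ?_⟩
  · refine isLocalMax_of_deriv hcont.continuousAt
      (Filter.Eventually.of_forall fun y => (hd y).differentiableAt) ?_ ?_
    · filter_upwards [self_mem_nhdsWithin] with y hy using (hneg y hy).le
    · have hsm : ∀ᶠ y in nhds η, a * Real.sinh ((y - η) / 2) < a ^ 2 - 1 := by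
        have hk : Continuous fun y : ℝ => a * Real.sinh ((y - η) / 2) := by fun_prop
        refine hk.continuousAt.eventually_lt continuousAt_const ?_
        have h1 : 0 < a ^ 2 - 1 := by nlinarith
        rw [sub_self, zero_div, Real.sinh_zero, mul_zero]
        exact h1
      filter_upwards [self_mem_nhdsWithin, nhdsWithin_le_nhds hsm] with y hy hs
      have hy' : η < y := hy
      have hs' : a * Real.sinh ((y - η) / 2) < a ^ 2 - 1 := hs
      rw [(hd y).deriv]
      have hu : 0 < Real.sinh ((y - η) / 2) := Real.sinh_pos_iff.2 (by linarith)
      have hc := Real.cosh_sq ((y - η) / 2)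
      have he := Real.add_one_le_exp (a * Real.sinh ((y - η) / 2))
      have hm : Real.exp (-(a * Real.sinh ((y - η) / 2))) *
          Real.exp (a * Real.sinh ((y - η) / 2)) = 1 := by
        rw [← Real.exp_add]; simp
      have hp := Real.exp_pos (-(a * Real.sinh ((y - η) / 2)))
      refine mul_nonpos_of_nonneg_of_nonpos (mul_pos (by linarith) (Real.exp_pos _)).le ?_
      clear hs hd hsm
      generalize Real.sinh ((y - η) / 2) = u at *
      rw [hc]
      generalize Real.exp (-(a * u)) = e at *
      have hau : 0 < a * u := by positivity
      have h0 : e * (1 + a * u) ≤ 1 := by nlinarith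
      have h1 : (1 + a * u) * (u + a * (u ^ 2 + 1) * (e - 1)) ≤ 0 := by
        have h2 : a * (u ^ 2 + 1) * ((1 + a * u) * (e - 1)) ≤ a * (u ^ 2 + 1) * (-(a * u)) :=
          mul_le_mul_of_nonneg_left (by linarith) (by positivity)
        have h3 : 1 + a * u ≤ a ^ 2 * (u ^ 2 + 1) := by
          nlinarith [mul_nonneg (sq_nonneg a) (sq_nonneg u)]
        nlinarith [mul_nonneg hu.le (sub_nonneg.2 h3)]
      by_contra hcon
      push Not at hcon
      have : 0 < (1 + a * u) * (u + a * (u ^ 2 + 1) * (e - 1)) := mul_pos (by linarith) hcon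
      linarith
  · refine strictMonoOn_of_deriv_pos (convex_Iio η) hcont.continuousOn ?_
    intro y hy
    rw [interior_Iio] at hy
    exact hneg y hy
end

section
/- Let α > 2, η ∈ ℝ, γ = 0, and let f be the log-EVBS(α,η,0) density. Then η is a local minimum point of f. -/
/-- Let `α > 2`, `η ∈ ℝ`, `γ = 0`, and let `f` be the
log-EVBS(α,η,0) density, i.e.
`f y = (1/2)·ξ₁(y)·exp(-ξ₂(y) - exp(-ξ₂(y)))` for all `y ∈ ℝ`, where
`ξ₁(y) = (2/α)·cosh((y-η)/2)` and `ξ₂(y) = (2/α)·sinh((y-η)/2)`.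
Then `η` is a local minimum point of `f`. -/
theorem logEVBS_isLocalMin_of_gamma_eq_zero_of_two_lt
    (α η : ℝ) (hα : 2 < α) (f : ℝ → ℝ)
    (hf : ∀ y : ℝ,
      f y = (1 / 2) * ((2 / α) * Real.cosh ((y - η) / 2)) *
        Real.exp (-((2 / α) * Real.sinh ((y - η) / 2)) -
          Real.exp (-((2 / α) * Real.sinh ((y - η) / 2))))) :
    IsLocalMin f η := by
  have hα0 : 0 < α := by linarith
  obtain ⟨b, hb⟩ : ∃ b, b = 2 / α := ⟨_, rfl⟩
  have hb0 : 0 < b := by rw [hb]; positivity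
  have hb1 : b < 1 := by rw [hb, div_lt_one hα0]; exact hα
  rw [← hb] at hf
  have hc : Continuous fun y : ℝ => Real.sinh ((y - η) / 2) :=
    Real.continuous_sinh.comp (by fun_prop)
  have e1 : ∀ᶠ y in nhds η, |b * Real.sinh ((y - η) / 2)| < 1 := by
    have h : Continuous fun y : ℝ => |b * Real.sinh ((y - η) / 2)| := by fun_prop
    apply h.continuousAt.eventually_lt continuousAt_const
    simp
  have e2 : ∀ᶠ y in nhds η, b ^ 2 * (1 / 2 + |b * Real.sinh ((y - η) / 2)|) *
      (1 + Real.sinh ((y - η) / 2) ^ 2) < 1 / 2 := by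
    have h : Continuous fun y : ℝ => b ^ 2 * (1 / 2 + |b * Real.sinh ((y - η) / 2)|) *
      (1 + Real.sinh ((y - η) / 2) ^ 2) := by fun_prop
    apply h.continuousAt.eventually_lt continuousAt_const
    simp
    rwa [abs_of_pos hb0]
  filter_upwards [e1, e2] with y h1 h2
  have hη : f η = (1 / 2) * b * Real.exp (-1) := by
    rw [hf]; simp
  rw [hη, hf]
  have hcp := Real.cosh_pos ((y - η) / 2)
  have hcs := Real.cosh_sq ((y - η) / 2)
  generalize Real.cosh ((y - η) / 2) = c at *
  generalize Real.sinh ((y - η) / 2) = s at *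
  have hx := Real.exp_bound (x := -(b * s)) (by rw [abs_neg]; exact h1.le) (n := 3) (by norm_num)
  rw [abs_neg] at hx
  have hx2 := (abs_le.mp hx).2
  simp [Finset.sum_range_succ, Nat.factorial] at hx2
  have hl := Real.one_sub_inv_le_log_of_pos (show 0 < c ^ 2 by positivity)
  rw [Real.log_pow] at hl
  push_cast at hl
  have key : b ^ 2 * s ^ 2 * (1 / 2 + |b * s|) ≤ 1 / 2 * (1 - (c ^ 2)⁻¹) := by
    have : 1 - (c ^ 2)⁻¹ = s ^ 2 / (1 + s ^ 2) := by
      rw [hcs]; field_simp; ring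
    rw [this, ← mul_div_assoc, le_div_iff₀ (by positivity)]
    nlinarith [mul_le_mul_of_nonneg_left h2.le (sq_nonneg s)]
  have h3 : |b * s| ^ 3 = b ^ 2 * s ^ 2 * |b * s| := by
    rw [pow_succ, sq_abs]; ring
  have h4 : 0 ≤ b ^ 2 * s ^ 2 * |b * s| := by positivity
  rw [abs_mul] at h3 h4 key
  have h5 : -1 ≤ Real.log c + (-(b * s) - Real.exp (-(b * s))) := by
    norm_num at hx2
    nlinarith
  have h6 := Real.exp_le_exp.mpr h5
  rw [Real.exp_add, Real.exp_log hcp] at h6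
  nlinarith [mul_le_mul_of_nonneg_left h6 hb0.le]
end

section
/- Fix α > 0, β > 0 and γ ∈ ℝ, and let μ_γ be the Borel probability measure on ℝ whose cumulative distribution function is the standard GEV(0,1,γ) cdf G_γ. Let T(x) = β·(αx/2 + √((αx/2)² + 1))². Then the function T is integrable with respect to μ_γ (i.e., ∫ T dμ_γ < ∞) if and only if γ < 1/2. -/
open MeasureTheory

/-- The standard GEV(0,1,γ) cumulative distribution function `G_γ`. -/
noncomputable def gevCdf (γ x : ℝ) : ℝ :=
  if γ = 0 then Real.exp (-Real.exp (-x))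
  else if 0 < 1 + γ * x then Real.exp (-(1 + γ * x) ^ (-1 / γ))
  else if 0 < γ then 0 else 1

lemma gev_tail_upper (γ : ℝ) (h : γ < 1 / 2) :
    ∃ p C : ℝ, 2 < p ∧ 0 ≤ C ∧ ∀ t : ℝ, 1 < t → 1 - gevCdf γ t ≤ C * t ^ (-p) := by
  rcases lt_trichotomy γ 0 with h0 | h0 | h0
  · refine ⟨3, (-1 / γ) ^ (3 : ℝ), by norm_num, ?_, ?_⟩
    · exact Real.rpow_nonneg (div_nonneg_of_nonpos (by norm_num) h0.le) _
    intro t ht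
    have hc : 0 ≤ -1 / γ := div_nonneg_of_nonpos (by norm_num) h0.le
    unfold gevCdf
    rw [if_neg h0.ne]
    split_ifs with h1 h2
    · have h3 : t ≤ -1 / γ := by
        rw [le_div_iff_of_neg h0]; nlinarith
      have h4 : t ^ (3 : ℝ) ≤ (-1 / γ) ^ (3 : ℝ) :=
        Real.rpow_le_rpow (by linarith) h3 (by norm_num)
      have h5 : 0 < t ^ (-3 : ℝ) := Real.rpow_pos_of_pos (by linarith) _
      have h6 : t ^ (3 : ℝ) * t ^ (-3 : ℝ) = 1 := by
        rw [← Real.rpow_add (by linarith)]; norm_num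
      have h7 := Real.exp_pos (-(1 + γ * t) ^ (-1 / γ))
      nlinarith
    · linarith
    · have h5 : 0 < t ^ (-3 : ℝ) := Real.rpow_pos_of_pos (by linarith) _
      have := Real.rpow_nonneg hc (3 : ℝ)
      simp only [sub_self]
      positivity
  · refine ⟨3, 6, by norm_num, by norm_num, ?_⟩
    intro t ht
    subst h0
    simp only [gevCdf, if_true]
    have h1 := Real.one_sub_le_exp_neg (Real.exp (-t))
    have h2 := Real.pow_div_factorial_le_exp t (by linarith) 3
    have h3 : t ^ (-3 : ℝ) = (t ^ 3)⁻¹ := by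
      rw [Real.rpow_neg (by linarith)]; norm_cast
    have h4 : Real.exp (-t) ≤ 6 * (t ^ 3)⁻¹ := by
      rw [Real.exp_neg]
      have h5 : 0 < t ^ 3 := by positivity
      have : (Real.exp t)⁻¹ ≤ (t ^ 3 / 6)⁻¹ := by
        apply inv_anti₀ (by positivity)
        simpa [Nat.factorial] using h2
      calc _ ≤ _ := this
        _ = _ := by field_simp
    rw [h3]; linarith
  · refine ⟨1 / γ, γ ^ (-(1 / γ)), ?_, (Real.rpow_pos_of_pos h0 _).le, ?_⟩
    · rw [lt_div_iff₀ h0]; linarith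
    intro t ht
    have h1 : 0 < 1 + γ * t := by positivity
    unfold gevCdf
    rw [if_neg h0.ne', if_pos h1, ← Real.mul_rpow h0.le (by linarith)]
    have h2 := Real.one_sub_le_exp_neg ((1 + γ * t) ^ (-1 / γ))
    have h3 : (1 + γ * t) ^ (-(1 / γ)) ≤ (γ * t) ^ (-(1 / γ)) :=
      Real.rpow_le_rpow_of_nonpos (by positivity) (by linarith)
        (by have : 0 < 1 / γ := by positivity
            linarith)
    rw [neg_div] at *
    linarith

lemma gev_tail_lower (γ : ℝ) (h : 1 / 2 ≤ γ) (t : ℝ) (ht : 1 < t) :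
    (1 / (2 * (1 + γ) ^ 2)) * t⁻¹ ≤ (1 - gevCdf γ t) * t := by
  have h0 : 0 < γ := by linarith
  have h1 : 1 ≤ 1 + γ * t := by nlinarith
  unfold gevCdf
  rw [if_neg h0.ne', if_pos (by linarith)]
  set u := (1 + γ * t) ^ (-1 / γ) with hu
  have hn : -1 / γ ≤ 0 := div_nonpos_of_nonpos_of_nonneg (by norm_num) h0.le
  have hu0 : 0 < u := Real.rpow_pos_of_pos (by linarith) _
  have hu1 : u ≤ 1 := Real.rpow_le_one_of_one_le_of_nonpos h1 hn
  have hu2 : ((1 + γ * t) ^ 2)⁻¹ ≤ u := by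
    have : (1 + γ * t) ^ (-2 : ℝ) ≤ u := by
      apply Real.rpow_le_rpow_of_exponent_le h1
      rw [le_div_iff₀ h0]; linarith
    rw [Real.rpow_neg (by linarith)] at this
    exact_mod_cast this
  have he : Real.exp (-u) ≤ 1 - u / 2 := by
    rw [Real.exp_neg]
    have := Real.add_one_le_exp u
    calc (Real.exp u)⁻¹ ≤ (u + 1)⁻¹ := inv_anti₀ (by linarith) this
      _ ≤ _ := by
        rw [inv_le_iff_one_le_mul₀ (by linarith)]; nlinarith
  have h3 : (((1 + γ) * t) ^ 2)⁻¹ ≤ ((1 + γ * t) ^ 2)⁻¹ := by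
    apply inv_anti₀ (by positivity)
    apply pow_le_pow_left₀ (by linarith)
    nlinarith
  have h4 : (((1 + γ) * t) ^ 2)⁻¹ / 2 ≤ 1 - Real.exp (-u) := by linarith
  calc _ = (((1 + γ) * t) ^ 2)⁻¹ / 2 * t := by field_simp
    _ ≤ _ := by gcongr

lemma evbs_integrable_iff_sq (α β : ℝ) (hα : 0 < α) (hβ : 0 < β)
    (μ : Measure ℝ) [IsProbabilityMeasure μ] :
    Integrable (fun x : ℝ =>
      β * (α * x / 2 + Real.sqrt ((α * x / 2) ^ 2 + 1)) ^ 2) μ ↔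
    Integrable (fun x : ℝ => (max x 0) ^ (2 : ℝ)) μ := by
  have e : (fun x : ℝ => (max x 0) ^ (2 : ℝ)) = fun x : ℝ => (max x 0) ^ 2 := by
    funext x; norm_cast
  rw [e]
  constructor
  · intro h
    refine (h.const_mul (1 / (β * α ^ 2))).mono' (by fun_prop) (ae_of_all _ fun x => ?_)
    rw [Real.norm_of_nonneg (by positivity)]
    rcases le_total x 0 with hx | hx
    · rw [max_eq_right hx]
      have : 0 ≤ 1 / (β * α ^ 2) *
          (β * (α * x / 2 + Real.sqrt ((α * x / 2) ^ 2 + 1)) ^ 2) := by positivity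
      simpa using this
    · rw [max_eq_left hx]
      have h1 : α * x / 2 ≤ Real.sqrt ((α * x / 2) ^ 2 + 1) :=
        Real.le_sqrt_of_sq_le (by linarith)
      have h2 : (α * x) ^ 2 ≤ (α * x / 2 + Real.sqrt ((α * x / 2) ^ 2 + 1)) ^ 2 := by
        apply pow_le_pow_left₀ (by positivity); linarith
      calc x ^ 2 = 1 / (β * α ^ 2) * (β * (α * x) ^ 2) := by field_simp
        _ ≤ _ := by gcongr
  · intro h
    refine ((h.const_mul (2 * β * α ^ 2)).add (integrable_const (2 * β))).mono'
      (by fun_prop) (ae_of_all _ fun x => ?_)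
    rw [Real.norm_of_nonneg (by positivity)]
    simp only [Pi.add_apply]
    have hs : Real.sqrt ((α * x / 2) ^ 2 + 1) ≤ |α * x / 2| + 1 := by
      apply Real.sqrt_le_iff.2 ⟨by positivity, ?_⟩
      nlinarith [sq_abs (α * x / 2), abs_nonneg (α * x / 2)]
    have hp : 0 ≤ α * x / 2 + Real.sqrt ((α * x / 2) ^ 2 + 1) := by
      have : |α * x / 2| ≤ Real.sqrt ((α * x / 2) ^ 2 + 1) :=
        Real.abs_le_sqrt (by linarith)
      linarith [neg_abs_le (α * x / 2)]
    have hb : α * x / 2 + Real.sqrt ((α * x / 2) ^ 2 + 1) ≤ α * max x 0 + 1 := by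
      rcases le_total x 0 with hx | hx
      · rw [max_eq_right hx]
        rw [abs_of_nonpos (by nlinarith)] at hs
        linarith
      · rw [max_eq_left hx]
        rw [abs_of_nonneg (by positivity)] at hs
        linarith
    have h2 := pow_le_pow_left₀ hp hb 2
    calc _ ≤ β * (α * max x 0 + 1) ^ 2 := by gcongr
      _ ≤ _ := by nlinarith [mul_nonneg hβ.le (sq_nonneg (α * max x 0 - 1))]

/-- Fix `α > 0`, `β > 0` and `γ ∈ ℝ`, and let `μ` be the Borel
probability measure on `ℝ` whose cdf is the standard GEV(0,1,γ) cdf `G_γ`.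
Let `T(x) = β·(αx/2 + √((αx/2)² + 1))²`.  Then `T` is integrable with respect
to `μ` if and only if `γ < 1/2`. -/
theorem evbs_integrable_iff_gamma_lt_half
    (α β γ : ℝ) (hα : 0 < α) (hβ : 0 < β)
    (μ : Measure ℝ) [IsProbabilityMeasure μ]
    (hcdf : ∀ x : ℝ, μ (Set.Iic x) = ENNReal.ofReal (gevCdf γ x)) :
    Integrable (fun x : ℝ =>
      β * (α * x / 2 + Real.sqrt ((α * x / 2) ^ 2 + 1)) ^ 2) μ ↔ γ < 1 / 2 := by
  have hG0 : ∀ t, 0 ≤ gevCdf γ t := by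
    intro t; unfold gevCdf; split_ifs <;> first | positivity | norm_num
  have hG : ∀ t, μ (Set.Ioi t) = ENNReal.ofReal (1 - gevCdf γ t) := by
    intro t
    rw [← Set.compl_Iic, prob_compl_eq_one_sub measurableSet_Iic, hcdf,
      ENNReal.ofReal_sub _ (hG0 t), ENNReal.ofReal_one]
  rw [evbs_integrable_iff_sq α β hα hβ μ, ← lintegral_ofReal_ne_top_iff_integrable
    (Measurable.aestronglyMeasurable (by fun_prop)) (ae_of_all _ fun x => by positivity),
    lintegral_rpow_eq_lintegral_meas_lt_mul μ (f := fun x => max x 0)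
      (ae_of_all _ fun x => le_max_right x 0) (by fun_prop) (by norm_num)]
  have e : ∫⁻ t in Set.Ioi (0 : ℝ), μ {a : ℝ | t < max a 0} * ENNReal.ofReal (t ^ ((2 : ℝ) - 1))
      = ∫⁻ t in Set.Ioi (0 : ℝ), ENNReal.ofReal (1 - gevCdf γ t) * ENNReal.ofReal t := by
    apply setLIntegral_congr_fun measurableSet_Ioi
    intro t ht
    have ht' : ¬ t < 0 := not_lt.2 (le_of_lt ht)
    have : {a : ℝ | t < max a 0} = Set.Ioi t := by
      ext a; simp [lt_max_iff, ht']
    simp only [this, hG]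
    norm_num
  rw [e]
  constructor
  · intro hfin
    by_contra hγ
    have hγ' : 1 / 2 ≤ γ := not_lt.1 hγ
    apply not_integrableOn_Ioi_inv (a := (1 : ℝ))
    have hc : 0 < 1 / (2 * (1 + γ) ^ 2) := by
      have : 0 < 1 + γ := by linarith
      positivity
    suffices hI : IntegrableOn (fun t : ℝ => 1 / (2 * (1 + γ) ^ 2) * t⁻¹) (Set.Ioi 1) by
      refine (hI.const_mul (1 / (2 * (1 + γ) ^ 2))⁻¹).congr (ae_of_all _ fun t => ?_)
      simp only
      rw [inv_mul_cancel_left₀ hc.ne']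
    refine (lintegral_ofReal_ne_top_iff_integrable
      (Measurable.aestronglyMeasurable (by fun_prop)) ?_).1 ?_
    · filter_upwards [ae_restrict_mem measurableSet_Ioi] with t ht
      have : (0 : ℝ) < t := lt_trans one_pos ht
      simp only [Pi.zero_apply]
      positivity
    · intro htop
      apply hfin
      rw [ENNReal.mul_eq_top]
      left
      refine ⟨by simp, ?_⟩
      rw [eq_top_iff, ← htop]
      refine le_trans (setLIntegral_mono' measurableSet_Ioi fun t ht => ?_)
        (lintegral_mono_set (Set.Ioi_subset_Ioi zero_le_one))
      have : (0 : ℝ) < t := lt_trans one_pos ht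
      rw [← ENNReal.ofReal_mul' this.le]
      exact ENNReal.ofReal_le_ofReal (gev_tail_lower γ hγ' t ht)
  · intro hγ
    obtain ⟨p, C, hp, hC, hle⟩ := gev_tail_upper γ hγ
    apply ENNReal.mul_ne_top ENNReal.ofReal_ne_top
    rw [← Set.Ioc_union_Ioi_eq_Ioi (zero_le_one (α := ℝ)),
      lintegral_union measurableSet_Ioi (Set.Ioc_disjoint_Ioi le_rfl)]
    apply ENNReal.add_ne_top.2 ⟨?_, ?_⟩
    · refine ne_top_of_le_ne_top (b := ∫⁻ t in Set.Ioc (0 : ℝ) 1, 1) (by simp) ?_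
      refine setLIntegral_mono' measurableSet_Ioc fun t ht => ?_
      rw [← ENNReal.ofReal_mul' ht.1.le, ← ENNReal.ofReal_one]
      apply ENNReal.ofReal_le_ofReal
      nlinarith [hG0 t, ht.1, ht.2]
    · have hI : IntegrableOn (fun t : ℝ => C * t ^ (-p + 1)) (Set.Ioi 1) :=
        (integrableOn_Ioi_rpow_of_lt (by linarith) one_pos).const_mul C
      refine ne_top_of_le_ne_top hI.lintegral_lt_top.ne ?_
      refine setLIntegral_mono' measurableSet_Ioi fun t ht => ?_
      have h0 : (0 : ℝ) < t := lt_trans one_pos ht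
      rw [← ENNReal.ofReal_mul' h0.le, Real.rpow_add_one h0.ne', ← mul_assoc]
      apply ENNReal.ofReal_le_ofReal
      gcongr
      exact hle t ht
end

section
/- Fix α > 0, β > 0 and γ ∈ ℝ, and let μ_γ be the Borel probability measure on ℝ whose cumulative distribution function is the standard GEV(0,1,γ) cdf G_γ. Let T(x) = β·(αx/2 + √((αx/2)² + 1))². Then the function T² is integrable with respect to μ_γ (i.e., ∫ T² dμ_γ < ∞) if and only if γ < 1/4. -/
open MeasureTheory

lemma evbs_layer (μ : Measure ℝ) :
    ∫⁻ x, ENNReal.ofReal ((max x 0) ^ (4:ℝ)) ∂μ =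
      ENNReal.ofReal 4 * ∫⁻ t in Set.Ioi (0:ℝ), μ (Set.Ioi t) * ENNReal.ofReal (t ^ (3:ℝ)) := by
  rw [lintegral_rpow_eq_lintegral_meas_lt_mul μ (Filter.Eventually.of_forall fun x => le_max_right x 0)
    (by fun_prop) (by norm_num)]
  congr 1
  refine setLIntegral_congr_fun measurableSet_Ioi fun t ht => ?_
  have h1 : {a : ℝ | t < max a 0} = Set.Ioi t := by
    ext a
    have : ¬ t < 0 := not_lt.2 (le_of_lt ht)
    simp [this]
  simp only [h1]
  norm_num

lemma evbs_fin (μ : Measure ℝ) [IsProbabilityMeasure μ] (C r T0 : ℝ) (hr : 4 < r) (hT : 0 < T0)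
    (hC : 0 ≤ C)
    (h : ∀ t, T0 < t → μ (Set.Ioi t) ≤ ENNReal.ofReal (C * t ^ (-r))) :
    ∫⁻ x, ENNReal.ofReal ((max x 0) ^ (4:ℝ)) ∂μ < ⊤ := by
  rw [evbs_layer]
  refine ENNReal.mul_lt_top ENNReal.ofReal_lt_top ?_
  rw [← Set.Ioc_union_Ioi_eq_Ioi hT.le]
  refine (lintegral_union_le _ _ _).trans_lt (ENNReal.add_lt_top.2 ⟨?_, ?_⟩)
  · calc _ ≤ ∫⁻ t in Set.Ioc 0 T0, ENNReal.ofReal (T0 ^ (3:ℝ)) := by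
          refine setLIntegral_mono' measurableSet_Ioc fun t ht => ?_
          calc _ ≤ 1 * ENNReal.ofReal (T0 ^ (3:ℝ)) := by
                refine mul_le_mul' prob_le_one (ENNReal.ofReal_le_ofReal ?_)
                exact Real.rpow_le_rpow ht.1.le ht.2 (by norm_num)
            _ = _ := one_mul _
      _ < ⊤ := by
          rw [setLIntegral_const]
          exact ENNReal.mul_lt_top ENNReal.ofReal_lt_top (by simp)
  · have hi : IntegrableOn (fun t : ℝ => C * t ^ (3 - r)) (Set.Ioi T0) :=
      (integrableOn_Ioi_rpow_of_lt (by linarith) hT).const_mul C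
    refine lt_of_le_of_lt ?_ hi.lintegral_lt_top
    refine setLIntegral_mono' measurableSet_Ioi fun t ht => ?_
    have ht0 : 0 < t := hT.trans ht
    calc _ ≤ ENNReal.ofReal (C * t ^ (-r)) * ENNReal.ofReal (t ^ (3:ℝ)) :=
          mul_le_mul' (h t ht) le_rfl
      _ = _ := by
          rw [← ENNReal.ofReal_mul (by positivity), mul_assoc, ← Real.rpow_add ht0]
          congr 3; ring

lemma evbs_inf (μ : Measure ℝ) (c : ℝ) (hc : 0 < c)
    (h : ∀ t, 1 < t → ENNReal.ofReal (c * t ^ (-4:ℝ)) ≤ μ (Set.Ioi t)) :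
    ¬ ∫⁻ x, ENNReal.ofReal ((max x 0) ^ (4:ℝ)) ∂μ < ⊤ := by
  rw [evbs_layer]
  intro hlt
  have h1 : ∫⁻ t in Set.Ioi (1:ℝ), ENNReal.ofReal (c * t ^ (-1:ℝ)) < ⊤ := by
    have h2 : ∫⁻ t in Set.Ioi (0:ℝ), μ (Set.Ioi t) * ENNReal.ofReal (t ^ (3:ℝ)) < ⊤ :=
      ENNReal.lt_top_of_mul_ne_top_right hlt.ne (by simp)
    refine lt_of_le_of_lt ?_ h2
    refine le_trans ?_ (lintegral_mono_set (Set.Ioi_subset_Ioi zero_le_one))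
    refine setLIntegral_mono' measurableSet_Ioi fun t ht => ?_
    have ht0 : 0 < t := zero_lt_one.trans ht
    refine le_trans (le_of_eq ?_) (mul_le_mul' (h t ht) le_rfl)
    rw [← ENNReal.ofReal_mul (by positivity), mul_assoc, ← Real.rpow_add ht0]
    norm_num
  have h3 : IntegrableOn (fun t : ℝ => c * t ^ (-1:ℝ)) (Set.Ioi 1) := by
    refine ⟨by fun_prop, ?_⟩
    rw [hasFiniteIntegral_iff_ofReal]
    · exact h1
    · filter_upwards [ae_restrict_mem measurableSet_Ioi] with t ht
      have ht0 : (0:ℝ) < t := zero_lt_one.trans ht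
      simp only [Pi.zero_apply]
      positivity
  have h4 : IntegrableOn (fun t : ℝ => t ^ (-1:ℝ)) (Set.Ioi 1) := by
    have := h3.const_mul c⁻¹
    simpa [← mul_assoc, inv_mul_cancel₀ hc.ne', IntegrableOn] using this
  rw [integrableOn_Ioi_rpow_iff one_pos] at h4
  exact lt_irrefl _ h4

lemma evbs_tail (γ : ℝ) (μ : Measure ℝ) [IsProbabilityMeasure μ]
    (hcdf : ∀ x : ℝ, μ (Set.Iic x) = ENNReal.ofReal (gevCdf γ x)) (t : ℝ) :
    μ (Set.Ioi t) = ENNReal.ofReal (1 - gevCdf γ t) := by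
  have h0 : 0 ≤ gevCdf γ t := by
    unfold gevCdf; split_ifs <;> positivity
  rw [← Set.compl_Iic, prob_compl_eq_one_sub measurableSet_Iic, hcdf, ENNReal.ofReal_sub _ h0,
    ENNReal.ofReal_one]

lemma evbs_moment (γ : ℝ) (μ : Measure ℝ) [IsProbabilityMeasure μ]
    (hcdf : ∀ x : ℝ, μ (Set.Iic x) = ENNReal.ofReal (gevCdf γ x)) :
    ∫⁻ x, ENNReal.ofReal ((max x 0) ^ (4:ℝ)) ∂μ < ⊤ ↔ γ < 1 / 4 := by
  constructor
  · intro hfin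
    by_contra hγ
    rw [not_lt] at hγ
    have hγ0 : 0 < γ := by linarith
    refine evbs_inf μ ((1 + γ) ^ (-4:ℝ) / 2) (by positivity) (fun t ht => ?_) hfin
    rw [evbs_tail γ μ hcdf]
    refine ENNReal.ofReal_le_ofReal ?_
    have ht0 : 0 < t := by linarith
    have hpos : 0 < 1 + γ * t := by positivity
    have hone : 1 ≤ 1 + γ * t := by nlinarith
    have he : -4 ≤ -1 / γ := by
      rw [le_div_iff₀ hγ0]; linarith
    rw [gevCdf, if_neg hγ0.ne', if_pos hpos]
    set u := (1 + γ * t) ^ (-1 / γ) with hu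
    have hu0 : 0 < u := by positivity
    have hu1 : u ≤ 1 := Real.rpow_le_one_of_one_le_of_nonpos hone
      (div_nonpos_of_nonpos_of_nonneg (by norm_num) hγ0.le)
    have h1 : ((1 + γ) * t) ^ (-4:ℝ) ≤ u :=
      (Real.rpow_le_rpow_of_nonpos hpos (by nlinarith) (by norm_num)).trans
        (Real.rpow_le_rpow_of_exponent_le hone he)
    rw [Real.mul_rpow (by positivity) ht0.le] at h1
    have h2 : Real.exp (-u) ≤ 1 - u / 2 := by
      rw [Real.exp_neg, inv_le_comm₀ (Real.exp_pos _) (by linarith)]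
      refine le_trans ?_ (Real.add_one_le_exp u)
      rw [inv_le_iff_one_le_mul₀ (by linarith)]
      nlinarith
    linarith
  · intro hγ
    rcases lt_trichotomy γ 0 with h | h | h
    · refine evbs_fin μ 0 5 (-1 / γ) (by norm_num) (div_pos_of_neg_of_neg (by norm_num) h) le_rfl
        fun t ht => ?_
      rw [evbs_tail γ μ hcdf]
      refine ENNReal.ofReal_le_ofReal ?_
      have : ¬ 0 < 1 + γ * t := by
        rw [div_lt_iff_of_neg h] at ht
        linarith
      rw [gevCdf, if_neg h.ne, if_neg this, if_neg h.not_gt]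
      simp
    · refine evbs_fin μ 120 5 1 (by norm_num) one_pos (by norm_num) fun t ht => ?_
      rw [evbs_tail γ μ hcdf]
      refine ENNReal.ofReal_le_ofReal ?_
      have ht0 : 0 < t := by linarith
      rw [gevCdf, if_pos h]
      have h1 := Real.add_one_le_exp (-Real.exp (-t))
      have h2 : Real.exp (-t) ≤ 120 * t ^ (-5:ℝ) := by
        have h3 := Real.pow_div_factorial_le_exp t ht0.le 5
        norm_num [Nat.factorial] at h3
        have h4 : t ^ (-5:ℝ) = (t ^ 5)⁻¹ := by
          rw [Real.rpow_neg ht0.le]; norm_cast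
        rw [h4, Real.exp_neg, ← div_eq_mul_inv, ← inv_div]
        exact inv_anti₀ (by positivity) h3
      linarith
    · refine evbs_fin μ (γ ^ (-1 / γ)) (1 / γ) 1 ?_ one_pos (by positivity) fun t ht => ?_
      · rw [lt_div_iff₀ h]; linarith
      rw [evbs_tail γ μ hcdf]
      refine ENNReal.ofReal_le_ofReal ?_
      have ht0 : 0 < t := by linarith
      have hpos : 0 < 1 + γ * t := by positivity
      rw [gevCdf, if_neg h.ne', if_pos hpos]
      have h1 := Real.add_one_le_exp (-(1 + γ * t) ^ (-1 / γ))
      have h2 : (1 + γ * t) ^ (-1 / γ) ≤ (γ * t) ^ (-1 / γ) :=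
        Real.rpow_le_rpow_of_nonpos (by positivity) (by linarith)
          (div_nonpos_of_nonpos_of_nonneg (by norm_num) h.le)
      rw [Real.mul_rpow h.le ht0.le] at h2
      rw [← neg_div]
      linarith

lemma evbs_lower (a : ℝ) : 2 * max a 0 ≤ a + Real.sqrt (a ^ 2 + 1) := by
  have h : |a| ≤ Real.sqrt (a ^ 2 + 1) := Real.abs_le_sqrt (by linarith)
  rcases le_total a 0 with h1 | h1
  · rw [max_eq_right h1]; rw [abs_of_nonpos h1] at h; linarith
  · rw [max_eq_left h1]; rw [abs_of_nonneg h1] at h; linarith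

lemma evbs_upper (a : ℝ) : a + Real.sqrt (a ^ 2 + 1) ≤ 2 * max a 0 + 1 := by
  have h : Real.sqrt (a ^ 2 + 1) ≤ |a| + 1 := by
    rw [Real.sqrt_le_left (by positivity)]
    nlinarith [abs_nonneg a, sq_abs a]
  rcases le_total a 0 with h1 | h1
  · rw [max_eq_right h1]; rw [abs_of_nonpos h1] at h; linarith
  · rw [max_eq_left h1]; rw [abs_of_nonneg h1] at h; linarith

lemma evbs_pow (a : ℝ) (ha : 0 ≤ a) : (a + 1) ^ 4 ≤ 8 * (a ^ 4 + 1) := by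
  nlinarith [sq_nonneg (a - 1), sq_nonneg (a ^ 2 - 1), sq_nonneg ((a - 1) * a),
    sq_nonneg ((a - 1) * (a + 1)), sq_nonneg ((a - 1) ^ 2)]

/-- Fix `α > 0`, `β > 0` and `γ ∈ ℝ`, and let `μ` be the Borel
probability measure on `ℝ` whose cdf is the standard GEV(0,1,γ) cdf `G_γ`.
Let `T(x) = β·(αx/2 + √((αx/2)² + 1))²`.  Then `T²` is integrable with respect
to `μ` if and only if `γ < 1/4`. -/
theorem evbs_sq_integrable_iff_gamma_lt_quarter
    (α β γ : ℝ) (hα : 0 < α) (hβ : 0 < β)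
    (μ : Measure ℝ) [IsProbabilityMeasure μ]
    (hcdf : ∀ x : ℝ, μ (Set.Iic x) = ENNReal.ofReal (gevCdf γ x)) :
    Integrable (fun x : ℝ =>
      (β * (α * x / 2 + Real.sqrt ((α * x / 2) ^ 2 + 1)) ^ 2) ^ 2) μ ↔ γ < 1 / 4 := by
  rw [← evbs_moment γ μ hcdf]
  have hint : ∫⁻ x, ENNReal.ofReal ((max x 0) ^ (4:ℝ)) ∂μ < ⊤ ↔
      Integrable (fun x : ℝ => (max x 0) ^ 4) μ := by
    have e : (fun x : ℝ => (max x 0) ^ (4:ℝ)) = fun x : ℝ => (max x 0) ^ 4 := by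
      funext x; norm_cast
    rw [← e, ← hasFiniteIntegral_iff_ofReal]
    · exact ⟨fun h => ⟨by rw [e]; fun_prop, h⟩, fun h => h.2⟩
    · exact Filter.Eventually.of_forall fun x => Real.rpow_nonneg (le_max_right x 0) _
  rw [hint]
  have hm : ∀ x : ℝ, 2 * max (α * x / 2) 0 = α * max x 0 := by
    intro x
    rcases le_total x 0 with h | h
    · rw [max_eq_right h, max_eq_right (by nlinarith)]; ring
    · rw [max_eq_left h, max_eq_left (by positivity)]; ring
  constructor
  · intro hI
    refine (hI.const_mul ((β ^ 2 * α ^ 4)⁻¹)).mono' (by fun_prop)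
      (Filter.Eventually.of_forall fun x => ?_)
    have h1 := evbs_lower (α * x / 2)
    rw [hm] at h1
    have h0 : 0 ≤ max x 0 := le_max_right x 0
    have h2 := pow_le_pow_left₀ (by positivity) h1 4
    rw [Real.norm_of_nonneg (by positivity), le_inv_mul_iff₀ (by positivity)]
    calc _ = β ^ 2 * (α * max x 0) ^ 4 := by ring
      _ ≤ β ^ 2 * (α * x / 2 + Real.sqrt ((α * x / 2) ^ 2 + 1)) ^ 4 := by gcongr
      _ = _ := by ring
  · intro hI
    refine (((hI.const_mul (α ^ 4)).add (integrable_const 1)).const_mul (β ^ 2 * 8)).mono'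
      (by fun_prop) (Filter.Eventually.of_forall fun x => ?_)
    have h0 : 0 ≤ max x 0 := le_max_right x 0
    have h1 := evbs_lower (α * x / 2)
    have h2 := evbs_upper (α * x / 2)
    rw [hm] at h1 h2
    have h3 : 0 ≤ α * max x 0 := by positivity
    have h4 := (pow_le_pow_left₀ (h3.trans h1) h2 4).trans (evbs_pow _ h3)
    rw [Real.norm_of_nonneg (by positivity)]
    calc _ = β ^ 2 * (α * x / 2 + Real.sqrt ((α * x / 2) ^ 2 + 1)) ^ 4 := by ring
      _ ≤ β ^ 2 * (8 * ((α * max x 0) ^ 4 + 1)) := by gcongr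
      _ = _ := by simp only [Pi.add_apply]; ring
end
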